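/- Let Δ consist, for 1 ≤ i ≤ t, of the clauses q_i ∨ d_i ∨ ¬e_i, ¬q_i ∨ ¬d_i, and ¬q_i ∨ e_i (the clausal form of q_i ↔ (¬d_i ∧ e_i)), where q_i is a fresh existential variable placed in the same quantifier block as d_i and e_i (so lv(q_i) < lv(x_i)), and let σ_{v,t} = { x_i ↦ q_i : 1 ≤ i ≤ t }. Then there is a constant c such that for every t ≥ 1, the formula Ψ_t has a tree refutation in IR-calc(P_t, M_t, Δ, σ_{v,t}) of size at most c·t^c (polynomial in t). -/

import Mathlib

/-! ## Propositional / QBF side -/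

inductive Lit where
  | pos (x : ℕ)
  | neg (x : ℕ)
deriving DecidableEq

def Lit.var : Lit → ℕ
  | pos x => x
  | neg x => x

def Lit.isPos : Lit → Bool
  | pos _ => true
  | neg _ => false

def Lit.negate : Lit → Lit
  | pos x => neg x
  | neg x => pos x

def Lit.eval (v : ℕ → Bool) : Lit → Bool
  | pos x => v x
  | neg x => !(v x)

abbrev Clause := Finset Lit

def Clause.Taut (C : Clause) : Prop := ∃ x, Lit.pos x ∈ C ∧ Lit.neg x ∈ C

/-- A prenex CNF: a list of quantifier blocks (`true` = existential,
`false` = universal), each with an ordered list of variables, and a matrix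
which is a finite set of clauses. -/
structure PCNF where
  blocks : List (Bool × List ℕ)
  matrix : Finset Clause

def PCNF.allVars (Φ : PCNF) : List ℕ := Φ.blocks.flatMap (·.2)

/-- Well-formedness: quantifier blocks alternate and the blocks are
pairwise disjoint sets of variables (no repetitions). -/
def PCNF.WF (Φ : PCNF) : Prop :=
  List.Chain' (fun a b => a.1 ≠ b.1) Φ.blocks ∧ Φ.allVars.Nodup ∧
    ∀ b ∈ Φ.blocks, b.2 ≠ []

/-- Closedness: every variable of the matrix is quantified in the prefix. -/
def PCNF.Closed (Φ : PCNF) : Prop :=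
  ∀ C ∈ Φ.matrix, ∀ l ∈ C, l.var ∈ Φ.allVars

def PCNF.existB (Φ : PCNF) (x : ℕ) : Bool :=
  Φ.blocks.any fun b => b.1 && b.2.contains x

def PCNF.univB (Φ : PCNF) (x : ℕ) : Bool :=
  Φ.blocks.any fun b => !b.1 && b.2.contains x

/-- The level of a variable: the index of its quantifier block. -/
def PCNF.lv (Φ : PCNF) (x : ℕ) : ℕ :=
  Φ.blocks.findIdx fun b => b.2.contains x

def evalClause (v : ℕ → Bool) (C : Clause) : Prop := ∃ l ∈ C, l.eval v = true

/-- Standard QBF semantics of a prenex CNF, evaluated block by block. -/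
def truthAux (M : Finset Clause) : List (Bool × List ℕ) → (ℕ → Bool) → Prop
  | [], v => ∀ C ∈ M, evalClause v C
  | (q, xs) :: rest, v =>
      if q then ∃ w : ℕ → Bool, (∀ y, y ∉ xs → w y = v y) ∧ truthAux M rest w
      else ∀ w : ℕ → Bool, (∀ y, y ∉ xs → w y = v y) → truthAux M rest w

def PCNF.IsTrue (Φ : PCNF) : Prop := truthAux Φ.matrix Φ.blocks fun _ => false

/-! ## Q-resolution and QU-resolution -/

/-- One derivation step of Q-res (`univPivot = false`) resp. QU-res
(`univPivot = true`) from the clauses derived so far. -/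
inductive QStep (Φ : PCNF) (univPivot : Bool) (prev : List Clause) : Clause → Prop
  | ax (C : Clause) (hC : C ∈ Φ.matrix) (hnt : ¬ C.Taut) : QStep Φ univPivot prev C
  | res (x : ℕ) (A B : Clause) (hA : A ∈ prev) (hB : B ∈ prev)
      (hxa : Lit.pos x ∈ A) (hxb : Lit.neg x ∈ B)
      (hpiv : Φ.existB x = true ∨ (univPivot = true ∧ Φ.univB x = true))
      (hblock : ∀ l ∈ A.erase (Lit.pos x), l.negate ∉ B.erase (Lit.neg x)) :
      QStep Φ univPivot prev ((A.erase (Lit.pos x)) ∪ (B.erase (Lit.neg x)))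
  | fac (A : Clause) (hA : A ∈ prev) : QStep Φ univPivot prev A
  | univRed (A : Clause) (m : Lit) (hA : A ∈ prev) (hm : m ∈ A)
      (hu : Φ.univB m.var = true)
      (hlv : ∀ l ∈ A.erase m, Φ.existB l.var = true → Φ.lv l.var < Φ.lv m.var) :
      QStep Φ univPivot prev (A.erase m)

def QValid (Φ : PCNF) (univPivot : Bool) (π : List Clause) : Prop :=
  ∀ i < π.length, QStep Φ univPivot (π.take i) π[i]!

def QRefutation (Φ : PCNF) (univPivot : Bool) (π : List Clause) : Prop :=
  QValid Φ univPivot π ∧ π ≠ [] ∧ π.getLast! = (∅ : Clause)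

/-- Size of a (QBF) resolution derivation: total number of literal
occurrences in its clauses. -/
def qSize (π : List Clause) : ℕ := (π.map Finset.card).sum

/-! ## First-order terms, atoms, literals, clauses -/

inductive FTerm where
  | var (x : ℕ)
  | app (f : ℕ) (args : List FTerm)

noncomputable instance : DecidableEq FTerm := Classical.decEq _

def FTerm.subst (σ : ℕ → FTerm) : FTerm → FTerm
  | .var x => σ x
  | .app f args => .app f (args.attach.map fun t => t.1.subst σ)
decreasing_by
  have := List.sizeOf_lt_of_mem t.2
  simp only [FTerm.app.sizeOf_spec]; omega

def FTerm.symSize : FTerm → ℕ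
  | .var _ => 1
  | .app _ args => 1 + (args.attach.map fun t => t.1.symSize).sum
decreasing_by
  have := List.sizeOf_lt_of_mem t.2
  simp only [FTerm.app.sizeOf_spec]; omega

def FTerm.vars : FTerm → Finset ℕ
  | .var x => {x}
  | .app _ args => (args.attach.map fun t => t.1.vars).foldr (· ∪ ·) ∅
decreasing_by
  have := List.sizeOf_lt_of_mem t.2
  simp only [FTerm.app.sizeOf_spec]; omega

/-- An atom `p(t₁,…,t_k)`: predicate symbol together with argument list. -/
structure FAtom where
  p : ℕ
  args : List FTerm

noncomputable instance : DecidableEq FAtom := Classical.decEq _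

def FAtom.subst (σ : ℕ → FTerm) (a : FAtom) : FAtom := ⟨a.p, a.args.map (FTerm.subst σ)⟩
def FAtom.symSize (a : FAtom) : ℕ := 1 + (a.args.map FTerm.symSize).sum
def FAtom.vars (a : FAtom) : Finset ℕ := (a.args.map FTerm.vars).foldr (· ∪ ·) ∅

inductive FLit where
  | pos (a : FAtom)
  | neg (a : FAtom)

noncomputable instance : DecidableEq FLit := Classical.decEq _

def FLit.atom : FLit → FAtom
  | pos a => a
  | neg a => a

def FLit.isPos : FLit → Bool
  | pos _ => true
  | neg _ => false

def FLit.subst (σ : ℕ → FTerm) : FLit → FLit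
  | pos a => pos (a.subst σ)
  | neg a => neg (a.subst σ)

def FLit.symSize (l : FLit) : ℕ :=
  match l with
  | .pos a => a.symSize
  | .neg a => 1 + a.symSize

abbrev FClause := Finset FLit

noncomputable def FClause.subst (σ : ℕ → FTerm) (C : FClause) : FClause :=
  C.image (FLit.subst σ)

noncomputable def FClause.symSize (C : FClause) : ℕ := ∑ l ∈ C, l.symSize

noncomputable def FClause.fvars (C : FClause) : Finset ℕ := C.sup fun l => l.atom.vars

/-! ## First-order resolution R1 -/

def compSub (σ μ : ℕ → FTerm) : ℕ → FTerm := fun x => (σ x).subst μ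

def Unifies (σ : ℕ → FTerm) (a b : FAtom) : Prop := a.subst σ = b.subst σ

def IsMGU (σ : ℕ → FTerm) (a b : FAtom) : Prop :=
  Unifies σ a b ∧ ∀ τ, Unifies τ a b → ∃ μ, ∀ x, compSub σ μ x = τ x

/-- `D` is a factor of `C`: `D = Cσ` for `σ` an mgu of two distinct
same-sign literals of `C`. -/
def IsFactor (C D : FClause) : Prop :=
  ∃ K L σ, K ∈ C ∧ L ∈ C ∧ K ≠ L ∧ K.isPos = L.isPos ∧
    IsMGU σ K.atom L.atom ∧ D = C.subst σ

def renameSub (ρ : ℕ → ℕ) : ℕ → FTerm := fun x => .var (ρ x)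

/-- `E` is a resolvent of `C` and `D`. -/
def IsResolvent (C D E : FClause) : Prop :=
  ∃ ρ : ℕ → ℕ, Function.Injective ρ ∧
    ∃ K L σ, Disjoint C.fvars (FClause.subst (renameSub ρ) D).fvars ∧
      K ∈ C ∧ L ∈ FClause.subst (renameSub ρ) D ∧ K.isPos = !L.isPos ∧
      IsMGU σ K.atom L.atom ∧
      E = ((C.subst σ).erase (K.subst σ)) ∪
          (((FClause.subst (renameSub ρ) D).subst σ).erase (L.subst σ))

def R1Valid (S : Set FClause) (π : List FClause) : Prop :=
  ∀ i < π.length,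
    π[i]! ∈ S ∨ (∃ j < i, IsFactor π[j]! π[i]!) ∨
      (∃ j < i, ∃ k < i, IsResolvent π[j]! π[k]! π[i]!)

def R1Refutation (S : Set FClause) (π : List FClause) : Prop :=
  R1Valid S π ∧ π ≠ [] ∧ π.getLast! = (∅ : FClause)

noncomputable def r1Size (π : List FClause) : ℕ := (π.map FClause.symSize).sum

/-- Tree-form R1 refutations: every clause occurrence is used at most once
as a premise, which is inherent in a tree-structured derivation. -/
inductive R1Tree (S : Set FClause) : FClause → Type
  | input (C : FClause) (h : C ∈ S) : R1Tree S C
  | factor {C : FClause} (t : R1Tree S C) (D : FClause) (h : IsFactor C D) : R1Tree S D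
  | resolve {C D : FClause} (t₁ : R1Tree S C) (t₂ : R1Tree S D) (E : FClause)
      (h : IsResolvent C D E) : R1Tree S E

noncomputable def R1Tree.size {S : Set FClause} : {C : FClause} → R1Tree S C → ℕ
  | C, .input _ _ => C.symSize
  | D, .factor t _ _ => t.size + D.symSize
  | E, .resolve t₁ t₂ _ _ => t₁.size + t₂.size + E.symSize

def R1Tree.clauseCount {S : Set FClause} : {C : FClause} → R1Tree S C → ℕ
  | _, .input _ _ => 1
  | _, .factor t _ _ => t.clauseCount + 1
  | _, .resolve t₁ t₂ _ _ => t₁.clauseCount + t₂.clauseCount + 1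

/-! ## The Skolem and EPR translations -/

/-- The universal variables strictly preceding `a` in the prefix,
in prefix order. -/
def PCNF.univBefore (Φ : PCNF) (a : ℕ) : List ℕ :=
  ((Φ.blocks.flatMap fun b => b.2.map fun x => (b.1, x)).takeWhile
      fun p => p.2 ≠ a).filterMap
    fun p => if p.1 = false then some p.2 else none

/-- `p` is the predicate symbol `0`; `f₀`, `f₁` are the constants `0`, `1`;
the Skolem function symbol for existential variable `a` is `a + 2`. -/
def skAtom (Φ : PCNF) (x : ℕ) : FAtom :=
  if Φ.existB x then ⟨0, [FTerm.app (x + 2) ((Φ.univBefore x).map FTerm.var)]⟩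
  else ⟨0, [FTerm.var x]⟩

def skLit (Φ : PCNF) : Lit → FLit
  | .pos x => .pos (skAtom Φ x)
  | .neg x => .neg (skAtom Φ x)

noncomputable def skClause (Φ : PCNF) (C : Clause) : FClause := C.image (skLit Φ)

def pf1Cl : FClause := {FLit.pos ⟨0, [FTerm.app 1 []]⟩}
def npf0Cl : FClause := {FLit.neg ⟨0, [FTerm.app 0 []]⟩}

/-- The clause set `Sk(Φ) ∪ {p(f₁), ¬p(f₀)}`. -/
noncomputable def skSet (Φ : PCNF) : Set FClause :=
  ↑(Φ.matrix.image (skClause Φ)) ∪ {pf1Cl, npf0Cl}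

/-- EPR atom: `p(f_a(u₁,…,u_k))` with `k ≥ 1` becomes `p_a(u₁,…,u_k)`,
where the fresh predicate symbol `p_a` is `a + 1`. -/
def eprAtom (Φ : PCNF) (x : ℕ) : FAtom :=
  if Φ.existB x then
    if Φ.univBefore x = [] then ⟨0, [FTerm.app (x + 2) []]⟩
    else ⟨x + 1, (Φ.univBefore x).map FTerm.var⟩
  else ⟨0, [FTerm.var x]⟩

def eprLit (Φ : PCNF) : Lit → FLit
  | .pos x => .pos (eprAtom Φ x)
  | .neg x => .neg (eprAtom Φ x)

noncomputable def eprClause (Φ : PCNF) (C : Clause) : FClause := C.image (eprLit Φ)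

/-- The clause set `EPR(Φ) ∪ {p(f₁), ¬p(f₀)}`. -/
noncomputable def eprSet (Φ : PCNF) : Set FClause :=
  ↑(Φ.matrix.image (eprClause Φ)) ∪ {pf1Cl, npf0Cl}

/-! ## IR-calc and its extensions -/

/-- An annotation: a (functional) finite set of assignments
`universal variable ↦ 0/1` (`false` = 0, `true` = 1). -/
abbrev Ann := Finset (ℕ × Bool)

def Ann.Functional (τ : Ann) : Prop := ∀ x b b', (x, b) ∈ τ → (x, b') ∈ τ → b = b'

/-- Restriction `[σ]` of an annotation to the universal variables of level
below the level of the literal `l`. -/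
def annRestr (Φ : PCNF) (σ : Ann) (l : Lit) : Ann :=
  σ.filter fun p => Φ.lv p.1 < Φ.lv l.var

/-- Completion of `μ` by `τ`. -/
def annCompl (μ τ : Ann) : Ann :=
  μ ∪ τ.filter fun p => p.1 ∉ μ.image Prod.fst

structure ALit where
  lit : Lit
  ann : Ann
deriving DecidableEq

abbrev AClause := Finset ALit

def ALit.symSize (al : ALit) : ℕ := 1 + 2 * al.ann.card
def AClause.symSize (A : AClause) : ℕ := ∑ al ∈ A, al.symSize
def aSize (π : List AClause) : ℕ := (π.map AClause.symSize).sum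

/-- The annotation extracted from the universal literals of a clause:
`u ↦ 0` for positive and `u ↦ 1` for negative universal literals. -/
def axAnn (Φ : PCNF) (C : Clause) : Ann :=
  (C.filter fun l => Φ.univB l.var).image fun l =>
    match l with
    | .pos u => (u, false)
    | .neg u => (u, true)

/-- The axiom clause of IR-calc obtained from a matrix clause. -/
def axClause (Φ : PCNF) (C : Clause) : AClause :=
  (C.filter fun l => Φ.existB l.var).image fun l => ⟨l, annRestr Φ (axAnn Φ C) l⟩

/-- Application of a variable substitution `σ_v` (universal ↦ existential)
to a literal. -/
def applySigv (σv : ℕ → Option ℕ) : Lit → Lit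
  | .pos x => match σv x with | some e => .pos e | none => .pos x
  | .neg x => match σv x with | some e => .neg e | none => .neg x

def Clause.applySigv (σv : ℕ → Option ℕ) (C : Clause) : Clause :=
  C.image (_root_.applySigv σv)

/-- Admissibility of `σ_v`: it maps universal variables to existential
variables of strictly smaller level. -/
def Admissible (Φ : PCNF) (σv : ℕ → Option ℕ) : Prop :=
  ∀ x e, σv x = some e → Φ.univB x = true ∧ Φ.existB e = true ∧ Φ.lv e < Φ.lv x

/-- One step of IR-calc(P, M, Δ, σ_v).  Plain IR-calc is the instance with
`Δ = ∅` and `σv = fun _ => none`; IR-calc^{σ_v} the instance with `Δ = ∅`. -/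
inductive IRStep (Φ : PCNF) (Δ : Finset Clause) (σv : ℕ → Option ℕ)
    (prev : List AClause) : AClause → Prop
  | ax (C : Clause) (hC : C ∈ Φ.matrix) (hnt : ¬ C.Taut)
      (hnt' : ¬ (C.applySigv σv).Taut) :
      IRStep Φ Δ σv prev (axClause Φ (C.applySigv σv))
  | axExt (C : Clause) (hC : C ∈ Δ) (hnt : ¬ C.Taut) :
      IRStep Φ Δ σv prev (C.image fun l => ⟨l, ∅⟩)
  | res (x : ℕ) (τ : Ann) (A B : AClause) (hA : A ∈ prev) (hB : B ∈ prev)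
      (hxa : (⟨Lit.pos x, τ⟩ : ALit) ∈ A) (hxb : (⟨Lit.neg x, τ⟩ : ALit) ∈ B) :
      IRStep Φ Δ σv prev ((A.erase ⟨Lit.pos x, τ⟩) ∪ (B.erase ⟨Lit.neg x, τ⟩))
  | fac (A : AClause) (hA : A ∈ prev) : IRStep Φ Δ σv prev A
  | inst (A : AClause) (τ : Ann) (hA : A ∈ prev) (hfun : τ.Functional)
      (hdom : ∀ p ∈ τ, Φ.univB p.1 = true) :
      IRStep Φ Δ σv prev
        (A.image fun al => ⟨al.lit, annRestr Φ (annCompl al.ann τ) al.lit⟩)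

def IRValid (Φ : PCNF) (Δ : Finset Clause) (σv : ℕ → Option ℕ)
    (π : List AClause) : Prop :=
  ∀ i < π.length, IRStep Φ Δ σv (π.take i) π[i]!

def IRRefutation (Φ : PCNF) (Δ : Finset Clause) (σv : ℕ → Option ℕ)
    (π : List AClause) : Prop :=
  IRValid Φ Δ σv π ∧ π ≠ [] ∧ π.getLast! = (∅ : AClause)

def noSub : ℕ → Option ℕ := fun _ => none

/-- Tree-form IR-calc(P, M, Δ, σ_v) derivations. -/
inductive IRTree (Φ : PCNF) (Δ : Finset Clause) (σv : ℕ → Option ℕ) : AClause → Type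
  | ax (C : Clause) (hC : C ∈ Φ.matrix) (hnt : ¬ C.Taut)
      (hnt' : ¬ (C.applySigv σv).Taut) : IRTree Φ Δ σv (axClause Φ (C.applySigv σv))
  | axExt (C : Clause) (hC : C ∈ Δ) (hnt : ¬ C.Taut) :
      IRTree Φ Δ σv (C.image fun l => ⟨l, ∅⟩)
  | res {A B : AClause} (t₁ : IRTree Φ Δ σv A) (t₂ : IRTree Φ Δ σv B)
      (x : ℕ) (τ : Ann)
      (hxa : (⟨Lit.pos x, τ⟩ : ALit) ∈ A) (hxb : (⟨Lit.neg x, τ⟩ : ALit) ∈ B) :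
      IRTree Φ Δ σv ((A.erase ⟨Lit.pos x, τ⟩) ∪ (B.erase ⟨Lit.neg x, τ⟩))
  | inst {A : AClause} (t : IRTree Φ Δ σv A) (τ : Ann) (hfun : τ.Functional)
      (hdom : ∀ p ∈ τ, Φ.univB p.1 = true) :
      IRTree Φ Δ σv (A.image fun al => ⟨al.lit, annRestr Φ (annCompl al.ann τ) al.lit⟩)

def IRTree.size {Φ : PCNF} {Δ : Finset Clause} {σv : ℕ → Option ℕ} :
    {A : AClause} → IRTree Φ Δ σv A → ℕ
  | _, .ax C _ _ _ => AClause.symSize (axClause Φ (C.applySigv σv))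
  | _, .axExt C _ _ => AClause.symSize (C.image fun l => (⟨l, ∅⟩ : ALit))
  | _, .res (A := A) (B := B) t₁ t₂ x τ _ _ =>
      t₁.size + t₂.size +
        AClause.symSize ((A.erase ⟨Lit.pos x, τ⟩) ∪ (B.erase ⟨Lit.neg x, τ⟩))
  | _, .inst (A := A) t τ _ _ =>
      t.size + AClause.symSize (A.image fun al =>
        (⟨al.lit, annRestr Φ (annCompl al.ann τ) al.lit⟩ : ALit))

/-! ## The formula families Φ_n and Ω_n (pigeonhole based) -/

def xv (i j : ℕ) : ℕ := Nat.pair 0 (Nat.pair i (Nat.pair j 0))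
def yv (i j : ℕ) : ℕ := Nat.pair 1 (Nat.pair i (Nat.pair j 0))
def zv (i₁ i₂ j : ℕ) : ℕ := Nat.pair 2 (Nat.pair i₁ (Nat.pair i₂ j))

def Xlist (n : ℕ) : List ℕ :=
  (List.range (n+1)).flatMap fun i => (List.range n).map fun j => xv (i+1) (j+1)
def Ylist (n : ℕ) : List ℕ :=
  (List.range (n+1)).flatMap fun i => (List.range n).map fun j => yv (i+1) (j+1)
def Zlist (n : ℕ) : List ℕ :=
  ((List.range (n+1)).map fun i => zv (i+1) 0 0) ++
  ((List.range n).flatMap fun j => (List.range (n+1)).flatMap fun i₁ =>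
    (List.range (n+1)).filterMap fun i₂ =>
      if i₁ < i₂ then some (zv (i₁+1) (i₂+1) (j+1)) else none)

/-- The clauses of PHP_n(X_n). -/
def PHPcls (n : ℕ) : Finset Clause :=
  ((List.range (n+1)).map fun i =>
      (((List.range n).map fun j => Lit.pos (xv (i+1) (j+1))).toFinset : Clause)).toFinset ∪
  ((List.range n).flatMap fun j => (List.range (n+1)).flatMap fun i₁ =>
    (List.range (n+1)).filterMap fun i₂ =>
      if i₁ < i₂ then
        some ({Lit.neg (xv (i₁+1) (j+1)), Lit.neg (xv (i₂+1) (j+1))} : Clause)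
      else none).toFinset

/-- The clauses of TPHP′_n(Y_n, Z_n). -/
def TPHPcls (n : ℕ) : Finset Clause :=
  {(((Zlist n).map Lit.neg).toFinset : Clause)} ∪
  ((List.range (n+1)).flatMap fun i => (List.range n).map fun j =>
      ({Lit.pos (zv (i+1) 0 0), Lit.neg (yv (i+1) (j+1))} : Clause)).toFinset ∪
  ((List.range n).flatMap fun j => (List.range (n+1)).flatMap fun i₁ =>
    (List.range (n+1)).flatMap fun i₂ =>
      if i₁ < i₂ then
        [({Lit.pos (zv (i₁+1) (i₂+1) (j+1)), Lit.pos (yv (i₁+1) (j+1))} : Clause),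
         ({Lit.pos (zv (i₁+1) (i₂+1) (j+1)), Lit.pos (yv (i₂+1) (j+1))} : Clause)]
      else []).toFinset

def phiMatrix (n : ℕ) : Finset Clause := TPHPcls n ∪ PHPcls n

/-- Φ_n = ∃X_n ∀Y_n ∃Z_n (TPHP′_n ∧ PHP_n). -/
def PhiF (n : ℕ) : PCNF :=
  ⟨[(true, Xlist n), (false, Ylist n), (true, Zlist n)], phiMatrix n⟩

/-- Ω_n = ∀Y_n ∃Z_n ∃X_n (TPHP′_n ∧ PHP_n) (Z_n and X_n form one block). -/
def OmegaF (n : ℕ) : PCNF :=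
  ⟨[(false, Ylist n), (true, Zlist n ++ Xlist n)], phiMatrix n⟩

/-! ## The formula family Ψ_t of Kleine Büning, Karpinski and Flögel -/

def dv (j : ℕ) : ℕ := 5*j
def ev (j : ℕ) : ℕ := 5*j+1
def xvv (j : ℕ) : ℕ := 5*j+2
def fv (j : ℕ) : ℕ := 5*j+3
def qv (j : ℕ) : ℕ := 5*j+4

/-- The prefix P_t; if `withQ` is set, the fresh extension variable `q_i`
is placed in the same existential block as `d_i` and `e_i`. -/
def psiPrefix (t : ℕ) (withQ : Bool) : List (Bool × List ℕ) :=
  ((true, [dv 0, dv 1, ev 1] ++ if withQ then [qv 1] else []) ::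
    (List.range (t-1)).flatMap fun j =>
      [(false, [xvv (j+1)]),
       (true, [dv (j+2), ev (j+2)] ++ if withQ then [qv (j+2)] else [])]) ++
  [(false, [xvv t]), (true, (List.range t).map fun i => fv (i+1))]

def fNegs (t : ℕ) : List Lit := (List.range t).map fun i => Lit.neg (fv (i+1))

def psiMatrix (t : ℕ) : Finset Clause :=
  ({({Lit.neg (dv 0)} : Clause),
    ({Lit.pos (dv 0), Lit.neg (dv 1), Lit.neg (ev 1)} : Clause),
    (((Lit.pos (dv t) :: Lit.neg (xvv t) :: fNegs t).toFinset : Clause)),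
    (((Lit.pos (ev t) :: Lit.pos (xvv t) :: fNegs t).toFinset : Clause))} : Finset Clause) ∪
  ((List.range (t-1)).flatMap fun j =>
     [({Lit.pos (dv (j+1)), Lit.neg (xvv (j+1)), Lit.neg (dv (j+2)), Lit.neg (ev (j+2))} : Clause),
      ({Lit.pos (ev (j+1)), Lit.pos (xvv (j+1)), Lit.neg (dv (j+2)), Lit.neg (ev (j+2))} : Clause)]).toFinset ∪
  ((List.range t).flatMap fun j =>
     [({Lit.neg (xvv (j+1)), Lit.pos (fv (j+1))} : Clause),
      ({Lit.pos (xvv (j+1)), Lit.pos (fv (j+1))} : Clause)]).toFinset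

def PsiF (t : ℕ) : PCNF := ⟨psiPrefix t false, psiMatrix t⟩

/-- Ψ_t with the extension variables q_i added to the prefix. -/
def PsiFq (t : ℕ) : PCNF := ⟨psiPrefix t true, psiMatrix t⟩

/-- The extension clauses Δ: clausal form of q_i ↔ (¬d_i ∧ e_i), 1 ≤ i ≤ t. -/
def DeltaT (t : ℕ) : Finset Clause :=
  ((List.range t).flatMap fun i =>
    [({Lit.pos (qv (i+1)), Lit.pos (dv (i+1)), Lit.neg (ev (i+1))} : Clause),
     ({Lit.neg (qv (i+1)), Lit.neg (dv (i+1))} : Clause),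
     ({Lit.neg (qv (i+1)), Lit.pos (ev (i+1))} : Clause)]).toFinset

/-- σ_{v,t} = { x_i ↦ q_i : 1 ≤ i ≤ t }. -/
def sigmaQv (t : ℕ) : ℕ → Option ℕ := fun v =>
  if v % 5 = 2 ∧ 1 ≤ v / 5 ∧ v / 5 ≤ t then some (5 * (v / 5) + 4) else none

/-- σ_{v,t} = { x_i ↦ e_i : 1 ≤ i ≤ t }. -/
def sigmaEv (t : ℕ) : ℕ → Option ℕ := fun v =>
  if v % 5 = 2 ∧ 1 ≤ v / 5 ∧ v / 5 ≤ t then some (5 * (v / 5) + 1) else none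

namespace PsiTree

/-- Plain clauses viewed as annotated clauses with empty annotations. -/
def emb (S : Clause) : AClause := S.image fun l => ⟨l, ∅⟩

/-- `S` has a tree derivation of size at most `n`. -/
def PDer (t : ℕ) (S : Clause) (n : ℕ) : Prop :=
  ∃ d : IRTree (PsiFq t) (DeltaT t) (sigmaQv t) (emb S), d.size ≤ n

theorem emb_inj : Function.Injective (fun l : Lit => (⟨l, ∅⟩ : ALit)) := by
  intro a b h
  simpa using h

theorem symSize_emb (S : Clause) : AClause.symSize (emb S) = S.card := by
  unfold AClause.symSize emb
  rw [Finset.sum_image (fun a _ b _ h => emb_inj h)]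
  simp [ALit.symSize]

theorem PDer.mono {t : ℕ} {S : Clause} {n m : ℕ} (h : PDer t S n) (hm : n ≤ m) : PDer t S m := by
  obtain ⟨d, hd⟩ := h
  exact ⟨d, hd.trans hm⟩

theorem PDer.res {t : ℕ} {A B : Clause} {a b : ℕ} (hA : PDer t A a) (hB : PDer t B b)
    (x : ℕ) (hxa : Lit.pos x ∈ A) (hxb : Lit.neg x ∈ B) (C : Clause)
    (hC : A.erase (Lit.pos x) ∪ B.erase (Lit.neg x) = C) (k : ℕ) (hk : C.card ≤ k) :
    PDer t C (a + b + k) := by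
  obtain ⟨d, hd⟩ := hA
  obtain ⟨e, he⟩ := hB
  have key : ((emb A).erase ⟨Lit.pos x, ∅⟩) ∪ ((emb B).erase ⟨Lit.neg x, ∅⟩) = emb C := by
    subst hC
    unfold emb
    rw [Finset.image_union, Finset.image_erase emb_inj, Finset.image_erase emb_inj]
  have h1 : (⟨Lit.pos x, ∅⟩ : ALit) ∈ emb A := Finset.mem_image_of_mem _ hxa
  have h2 : (⟨Lit.neg x, ∅⟩ : ALit) ∈ emb B := Finset.mem_image_of_mem _ hxb
  have : ∃ r : IRTree (PsiFq t) (DeltaT t) (sigmaQv t)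
      (((emb A).erase ⟨Lit.pos x, ∅⟩) ∪ ((emb B).erase ⟨Lit.neg x, ∅⟩)),
      r.size ≤ a + b + k := by
    refine ⟨IRTree.res d e x ∅ h1 h2, ?_⟩
    simp only [IRTree.size]
    rw [key, symSize_emb]
    omega
  rw [key] at this
  exact this

theorem univB_false (t x : ℕ) (hx : x % 5 ≠ 2) : (PsiFq t).univB x = false := by
  rw [← Bool.not_eq_true]
  intro h
  simp only [PCNF.univB, PsiFq, psiPrefix, xvv, List.any_eq_true, List.mem_append, List.mem_cons,
    List.mem_flatMap, List.mem_range, List.not_mem_nil, or_false] at h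
  obtain ⟨b, hb, h⟩ := h
  rcases hb with (rfl | ⟨j, hj, rfl | rfl⟩) | rfl | rfl <;> simp at h <;> omega

theorem PDer.ax {t : ℕ} (C : Clause) (hC : C ∈ (PsiFq t).matrix) (D : Clause)
    (hD : C.applySigv (sigmaQv t) = D) (hnt : ¬ C.Taut) (hnt' : ¬ D.Taut)
    (hE : ∀ l ∈ D, (PsiFq t).existB l.var = true) (hU : ∀ l ∈ D, l.var % 5 ≠ 2)
    (k : ℕ) (hk : D.card ≤ k) : PDer t D k := by
  have h1 : axClause (PsiFq t) D = emb D := by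
    have h2 : axAnn (PsiFq t) D = ∅ := by
      unfold axAnn
      rw [Finset.filter_false_of_mem]
      · simp
      · intro l hl
        simp [univB_false t _ (hU l hl)]
    unfold axClause emb
    rw [Finset.filter_true_of_mem (fun l hl => hE l hl), h2]
    simp [annRestr]
  have : ∃ r : IRTree (PsiFq t) (DeltaT t) (sigmaQv t)
      (axClause (PsiFq t) (C.applySigv (sigmaQv t))), r.size ≤ k := by
    refine ⟨IRTree.ax C hC hnt (by rw [hD]; exact hnt'), ?_⟩
    simp only [IRTree.size]
    rw [hD, h1, symSize_emb]
    exact hk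
  rw [hD, h1] at this
  exact this

theorem PDer.axExt {t : ℕ} (C : Clause) (hC : C ∈ DeltaT t) (hnt : ¬ C.Taut)
    (k : ℕ) (hk : C.card ≤ k) : PDer t C k := by
  refine ⟨IRTree.axExt C hC hnt, ?_⟩
  simp only [IRTree.size]
  rw [show (C.image fun l => (⟨l, ∅⟩ : ALit)) = emb C from rfl, symSize_emb]
  exact hk

theorem exist_d (t j : ℕ) (ht : 1 ≤ t) (hj : j ≤ t) : (PsiFq t).existB (dv j) = true := by
  simp only [PCNF.existB, PsiFq, psiPrefix, List.any_eq_true, List.mem_append, List.mem_cons,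
    List.mem_flatMap, List.mem_range, List.not_mem_nil, or_false]
  by_cases h : j ≤ 1
  · refine ⟨_, Or.inl (Or.inl rfl), ?_⟩
    interval_cases j <;> simp
  · refine ⟨_, Or.inl (Or.inr ⟨j - 2, by omega, Or.inr rfl⟩), ?_⟩
    simp [show j - 2 + 2 = j by omega]

theorem exist_e (t j : ℕ) (hj0 : 1 ≤ j) (hj : j ≤ t) : (PsiFq t).existB (ev j) = true := by
  simp only [PCNF.existB, PsiFq, psiPrefix, List.any_eq_true, List.mem_append, List.mem_cons,
    List.mem_flatMap, List.mem_range, List.not_mem_nil, or_false]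
  by_cases h : j ≤ 1
  · refine ⟨_, Or.inl (Or.inl rfl), ?_⟩
    interval_cases j; simp
  · refine ⟨_, Or.inl (Or.inr ⟨j - 2, by omega, Or.inr rfl⟩), ?_⟩
    simp [show j - 2 + 2 = j by omega]

theorem exist_q (t j : ℕ) (hj0 : 1 ≤ j) (hj : j ≤ t) : (PsiFq t).existB (qv j) = true := by
  simp only [PCNF.existB, PsiFq, psiPrefix, List.any_eq_true, List.mem_append, List.mem_cons,
    List.mem_flatMap, List.mem_range, List.not_mem_nil, or_false]
  by_cases h : j ≤ 1
  · refine ⟨_, Or.inl (Or.inl rfl), ?_⟩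
    interval_cases j; simp
  · refine ⟨_, Or.inl (Or.inr ⟨j - 2, by omega, Or.inr rfl⟩), ?_⟩
    simp [show j - 2 + 2 = j by omega]

theorem exist_f (t j : ℕ) (hj : j < t) : (PsiFq t).existB (fv (j + 1)) = true := by
  simp only [PCNF.existB, PsiFq, psiPrefix, List.any_eq_true, List.mem_append, List.mem_cons,
    List.mem_flatMap, List.mem_range, List.not_mem_nil, or_false]
  refine ⟨_, Or.inr (Or.inr rfl), ?_⟩
  simp [fv, hj]

theorem app_x_pos (t j : ℕ) (h1 : 1 ≤ j) (h2 : j ≤ t) :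
    applySigv (sigmaQv t) (Lit.pos (xvv j)) = Lit.pos (qv j) := by
  have : sigmaQv t (xvv j) = some (qv j) := by
    unfold sigmaQv xvv qv
    rw [if_pos (by omega)]
    congr 1; omega
  simp [applySigv, this]

theorem app_x_neg (t j : ℕ) (h1 : 1 ≤ j) (h2 : j ≤ t) :
    applySigv (sigmaQv t) (Lit.neg (xvv j)) = Lit.neg (qv j) := by
  have : sigmaQv t (xvv j) = some (qv j) := by
    unfold sigmaQv xvv qv
    rw [if_pos (by omega)]
    congr 1; omega
  simp [applySigv, this]

theorem app_other (t : ℕ) (l : Lit) (h : l.var % 5 ≠ 2) : applySigv (sigmaQv t) l = l := by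
  have : sigmaQv t l.var = none := by
    unfold sigmaQv
    rw [if_neg (by omega)]
  cases l <;> simp_all [applySigv, Lit.var]

theorem app_d_pos (t j : ℕ) : applySigv (sigmaQv t) (Lit.pos (dv j)) = Lit.pos (dv j) :=
  app_other t _ (by simp only [Lit.var, dv]; omega)
theorem app_d_neg (t j : ℕ) : applySigv (sigmaQv t) (Lit.neg (dv j)) = Lit.neg (dv j) :=
  app_other t _ (by simp only [Lit.var, dv]; omega)
theorem app_e_pos (t j : ℕ) : applySigv (sigmaQv t) (Lit.pos (ev j)) = Lit.pos (ev j) :=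
  app_other t _ (by simp only [Lit.var, ev]; omega)
theorem app_e_neg (t j : ℕ) : applySigv (sigmaQv t) (Lit.neg (ev j)) = Lit.neg (ev j) :=
  app_other t _ (by simp only [Lit.var, ev]; omega)
theorem app_f_pos (t j : ℕ) : applySigv (sigmaQv t) (Lit.pos (fv j)) = Lit.pos (fv j) :=
  app_other t _ (by simp only [Lit.var, fv]; omega)
theorem app_f_neg (t j : ℕ) : applySigv (sigmaQv t) (Lit.neg (fv j)) = Lit.neg (fv j) :=
  app_other t _ (by simp only [Lit.var, fv]; omega)

/-- The tail `¬f_{k+1}, …, ¬f_t`. -/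
def tail (t k : ℕ) : Clause := (Finset.Ico k t).image fun i => Lit.neg (fv (i + 1))

theorem tail_zero (t : ℕ) : (fNegs t).toFinset = tail t 0 := by
  ext l; simp [fNegs, tail]

theorem tail_app (t k : ℕ) : (tail t k).image (applySigv (sigmaQv t)) = tail t k := by
  unfold tail
  rw [Finset.image_image]
  congr 1
  funext i
  exact app_f_neg t _

theorem tail_card (t k : ℕ) : (tail t k).card ≤ t := by
  unfold tail
  refine Finset.card_image_le.trans ?_
  simp

theorem mem_tail {t k : ℕ} {l : Lit} :
    l ∈ tail t k ↔ ∃ i, k ≤ i ∧ i < t ∧ l = Lit.neg (fv (i + 1)) := by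
  simp only [tail, Finset.mem_image, Finset.mem_Ico]
  constructor
  · rintro ⟨i, ⟨h1, h2⟩, rfl⟩; exact ⟨i, h1, h2, rfl⟩
  · rintro ⟨i, h1, h2, rfl⟩; exact ⟨i, ⟨h1, h2⟩, rfl⟩

theorem ax_C0 (t : ℕ) (ht : 1 ≤ t) : PDer t {Lit.neg (dv 0)} 1 := by
  refine PDer.ax {Lit.neg (dv 0)} (by simp [PsiFq, psiMatrix]) _ ?_ ?_ ?_ ?_ ?_ _ (by simp)
  · simp [Clause.applySigv, app_d_neg]
  · simp [Clause.Taut]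
  · simp [Clause.Taut]
  · simp [Lit.var, exist_d t 0 ht]
  · simp [Lit.var, dv]

theorem ax_C1 (t : ℕ) (ht : 1 ≤ t) :
    PDer t {Lit.pos (dv 0), Lit.neg (dv 1), Lit.neg (ev 1)} 3 := by
  refine PDer.ax {Lit.pos (dv 0), Lit.neg (dv 1), Lit.neg (ev 1)} (by simp [PsiFq, psiMatrix]) _
    ?_ ?_ ?_ ?_ ?_ _ Finset.card_le_three
  · simp [Clause.applySigv, app_d_neg, app_d_pos, app_e_neg]
  · simp [Clause.Taut, dv, ev]
  · simp [Clause.Taut, dv, ev]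
  · simp [Lit.var, exist_d t 0 ht, exist_d t 1 ht ht, exist_e t 1 le_rfl ht]
  · simp [Lit.var, dv, ev]

theorem ax_even (t j : ℕ) (hj : j + 1 < t) :
    PDer t {Lit.pos (dv (j+1)), Lit.neg (qv (j+1)), Lit.neg (dv (j+2)), Lit.neg (ev (j+2))} 4 := by
  refine PDer.ax
    {Lit.pos (dv (j+1)), Lit.neg (xvv (j+1)), Lit.neg (dv (j+2)), Lit.neg (ev (j+2))} ?_ _
    ?_ ?_ ?_ ?_ ?_ _ Finset.card_le_four
  · simp only [PsiFq, psiMatrix, Finset.mem_union, List.mem_toFinset, List.mem_flatMap]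
    exact Or.inl (Or.inr ⟨j, by simp; omega, by simp⟩)
  · simp [Clause.applySigv, app_d_neg, app_d_pos, app_e_neg, app_x_neg t (j+1) (by omega) (by omega)]
  · simp [Clause.Taut, dv, ev, xvv] <;> omega
  · simp [Clause.Taut, dv, ev, qv] <;> omega
  · simp [Lit.var, exist_d t (j+1) (by omega) (by omega), exist_d t (j+2) (by omega) (by omega),
      exist_e t (j+2) (by omega) (by omega), exist_q t (j+1) (by omega) (by omega)]
  · simp [Lit.var, dv, ev, qv] <;> omega

theorem ax_odd (t j : ℕ) (hj : j + 1 < t) :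
    PDer t {Lit.pos (ev (j+1)), Lit.pos (qv (j+1)), Lit.neg (dv (j+2)), Lit.neg (ev (j+2))} 4 := by
  refine PDer.ax
    {Lit.pos (ev (j+1)), Lit.pos (xvv (j+1)), Lit.neg (dv (j+2)), Lit.neg (ev (j+2))} ?_ _
    ?_ ?_ ?_ ?_ ?_ _ Finset.card_le_four
  · simp only [PsiFq, psiMatrix, Finset.mem_union, List.mem_toFinset, List.mem_flatMap]
    exact Or.inl (Or.inr ⟨j, by simp; omega, by simp⟩)
  · simp [Clause.applySigv, app_d_neg, app_e_pos, app_e_neg, app_x_pos t (j+1) (by omega) (by omega)]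
  · simp [Clause.Taut, dv, ev, xvv] <;> omega
  · simp [Clause.Taut, dv, ev, qv] <;> omega
  · simp [Lit.var, exist_e t (j+1) (by omega) (by omega), exist_d t (j+2) (by omega) (by omega),
      exist_e t (j+2) (by omega) (by omega), exist_q t (j+1) (by omega) (by omega)]
  · simp [Lit.var, dv, ev, qv] <;> omega

theorem der_f (t j : ℕ) (hj : j < t) : PDer t {Lit.pos (fv (j+1))} 5 := by
  have h1 : PDer t {Lit.neg (qv (j+1)), Lit.pos (fv (j+1))} 2 := by
    refine PDer.ax {Lit.neg (xvv (j+1)), Lit.pos (fv (j+1))} ?_ _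
      ?_ ?_ ?_ ?_ ?_ _ Finset.card_le_two
    · simp only [PsiFq, psiMatrix, Finset.mem_union, List.mem_toFinset, List.mem_flatMap]
      exact Or.inr ⟨j, by simp; omega, by simp⟩
    · simp [Clause.applySigv, app_f_pos, app_x_neg t (j+1) (by omega) (by omega)]
    · simp [Clause.Taut, fv, xvv] <;> omega
    · simp [Clause.Taut, fv, qv] <;> omega
    · simp [Lit.var, exist_f t j hj, exist_q t (j+1) (by omega) (by omega)]
    · simp [Lit.var, fv, qv] <;> omega
  have h2 : PDer t {Lit.pos (qv (j+1)), Lit.pos (fv (j+1))} 2 := by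
    refine PDer.ax {Lit.pos (xvv (j+1)), Lit.pos (fv (j+1))} ?_ _
      ?_ ?_ ?_ ?_ ?_ _ Finset.card_le_two
    · simp only [PsiFq, psiMatrix, Finset.mem_union, List.mem_toFinset, List.mem_flatMap]
      exact Or.inr ⟨j, by simp; omega, by simp⟩
    · simp [Clause.applySigv, app_f_pos, app_x_pos t (j+1) (by omega) (by omega)]
    · simp [Clause.Taut]
    · simp [Clause.Taut]
    · simp [Lit.var, exist_f t j hj, exist_q t (j+1) (by omega) (by omega)]
    · simp [Lit.var, fv, qv] <;> omega
  refine PDer.res h2 h1 (qv (j+1)) (by simp) (by simp) _ ?_ 1 (by simp)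
  have : qv (j+1) ≠ fv (j+1) := by simp [qv, fv]
  ext l; simp <;> grind

theorem strip_f (t : ℕ) (S : Clause) (hS : ∀ i, Lit.neg (fv i) ∉ S) (hc : S.card ≤ 2)
    (h : PDer t (S ∪ tail t 0) (t + 2)) :
    ∀ k ≤ t, PDer t (S ∪ tail t k) ((t + 2) + k * (t + 7)) := by
  intro k
  induction k with
  | zero => intro _; simpa using h
  | succ k ih =>
    intro hk
    have h1 := ih (by omega)
    have h2 := der_f t k (by omega)
    refine (PDer.res h2 h1 (fv (k+1)) (by simp) ?_ _ ?_ (t + 2) ?_).mono ?_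
    · rw [Finset.mem_union, mem_tail]
      exact Or.inr ⟨k, le_rfl, by omega, rfl⟩
    · ext l
      have := hS (k+1)
      simp only [Finset.mem_union, Finset.mem_erase, Finset.mem_singleton, mem_tail]
      constructor
      · rintro (⟨h, h'⟩ | ⟨h, h' | ⟨i, h3, h4, rfl⟩⟩)
        · exact absurd h' h
        · exact Or.inl h'
        · refine Or.inr ⟨i, ?_, h4, rfl⟩
          rcases Nat.lt_or_ge k i with h5 | h5
          · exact h5
          · exact absurd (by rw [show i = k by omega]) h
      · rintro (h | ⟨i, h3, h4, rfl⟩)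
        · exact Or.inr ⟨fun h5 => this (h5 ▸ h), Or.inl h⟩
        · refine Or.inr ⟨?_, Or.inr ⟨i, by omega, h4, rfl⟩⟩
          simp [fv] <;> omega
    · refine (Finset.card_union_le _ _).trans ?_
      have := tail_card t (k+1)
      omega
    · rw [Nat.succ_mul]; omega

theorem last_even (t : ℕ) (ht : 1 ≤ t) :
    PDer t {Lit.pos (dv t), Lit.neg (qv t)} ((t + 2) + t * (t + 7)) := by
  have h0 : PDer t ({Lit.pos (dv t), Lit.neg (qv t)} ∪ tail t 0) (t + 2) := by
    refine PDer.ax ({Lit.pos (dv t), Lit.neg (xvv t)} ∪ tail t 0) ?_ _ ?_ ?_ ?_ ?_ ?_ _ ?_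
    · have : ({Lit.pos (dv t), Lit.neg (xvv t)} ∪ tail t 0 : Clause)
          = (Lit.pos (dv t) :: Lit.neg (xvv t) :: fNegs t).toFinset := by
        rw [← tail_zero]; ext l; simp
      rw [this]
      simp [PsiFq, psiMatrix]
    · rw [Clause.applySigv, Finset.image_union, tail_app]
      simp [app_d_pos, app_x_neg t t ht le_rfl]
    · rintro ⟨x, h1, h2⟩
      simp only [Finset.mem_union, Finset.mem_insert, Finset.mem_singleton, mem_tail, Lit.pos.injEq,
        Lit.neg.injEq, reduceCtorEq, false_or, or_false, and_false, exists_false, dv, xvv, fv] at h1 h2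
      rcases h2 with h2 | ⟨i, _, _, h2⟩ <;> omega
    · rintro ⟨x, h1, h2⟩
      simp only [Finset.mem_union, Finset.mem_insert, Finset.mem_singleton, mem_tail, Lit.pos.injEq,
        Lit.neg.injEq, reduceCtorEq, false_or, or_false, and_false, exists_false, dv, qv, fv] at h1 h2
      rcases h2 with h2 | ⟨i, _, _, h2⟩ <;> omega
    · intro l hl
      simp only [Finset.mem_union, Finset.mem_insert, Finset.mem_singleton, mem_tail] at hl
      rcases hl with (rfl | rfl) | ⟨i, _, hi, rfl⟩
      · exact exist_d t t ht le_rfl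
      · exact exist_q t t ht le_rfl
      · exact exist_f t i hi
    · intro l hl
      simp only [Finset.mem_union, Finset.mem_insert, Finset.mem_singleton, mem_tail] at hl
      rcases hl with (rfl | rfl) | ⟨i, _, hi, rfl⟩ <;> simp only [Lit.var, dv, qv, fv] <;> omega
    · refine (Finset.card_union_le _ _).trans ?_
      have := tail_card t 0
      have : ({Lit.pos (dv t), Lit.neg (qv t)} : Clause).card ≤ 2 := Finset.card_le_two
      omega
  have := strip_f t _ (by intro i; simp [qv, fv]; omega) Finset.card_le_two h0 t le_rfl
  simpa [tail] using this

theorem last_odd (t : ℕ) (ht : 1 ≤ t) :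
    PDer t {Lit.pos (ev t), Lit.pos (qv t)} ((t + 2) + t * (t + 7)) := by
  have h0 : PDer t ({Lit.pos (ev t), Lit.pos (qv t)} ∪ tail t 0) (t + 2) := by
    refine PDer.ax ({Lit.pos (ev t), Lit.pos (xvv t)} ∪ tail t 0) ?_ _ ?_ ?_ ?_ ?_ ?_ _ ?_
    · have : ({Lit.pos (ev t), Lit.pos (xvv t)} ∪ tail t 0 : Clause)
          = (Lit.pos (ev t) :: Lit.pos (xvv t) :: fNegs t).toFinset := by
        rw [← tail_zero]; ext l; simp
      rw [this]
      simp [PsiFq, psiMatrix]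
    · rw [Clause.applySigv, Finset.image_union, tail_app]
      simp [app_e_pos, app_x_pos t t ht le_rfl]
    · rintro ⟨x, h1, h2⟩
      simp only [Finset.mem_union, Finset.mem_insert, Finset.mem_singleton, mem_tail, Lit.pos.injEq,
        Lit.neg.injEq, reduceCtorEq, false_or, or_false, and_false, exists_false, ev, xvv, fv] at h1 h2
      obtain ⟨i, _, _, h2⟩ := h2
      omega
    · rintro ⟨x, h1, h2⟩
      simp only [Finset.mem_union, Finset.mem_insert, Finset.mem_singleton, mem_tail, Lit.pos.injEq,
        Lit.neg.injEq, reduceCtorEq, false_or, or_false, and_false, exists_false, ev, qv, fv] at h1 h2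
      obtain ⟨i, _, _, h2⟩ := h2
      omega
    · intro l hl
      simp only [Finset.mem_union, Finset.mem_insert, Finset.mem_singleton, mem_tail] at hl
      rcases hl with (rfl | rfl) | ⟨i, _, hi, rfl⟩
      · exact exist_e t t ht le_rfl
      · exact exist_q t t ht le_rfl
      · exact exist_f t i hi
    · intro l hl
      simp only [Finset.mem_union, Finset.mem_insert, Finset.mem_singleton, mem_tail] at hl
      rcases hl with (rfl | rfl) | ⟨i, _, hi, rfl⟩ <;> simp only [Lit.var, ev, qv, fv] <;> omega
    · refine (Finset.card_union_le _ _).trans ?_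
      have := tail_card t 0
      have : ({Lit.pos (ev t), Lit.pos (qv t)} : Clause).card ≤ 2 := Finset.card_le_two
      omega
  have := strip_f t _ (by intro i; simp) Finset.card_le_two h0 t le_rfl
  simpa [tail] using this

/-- One level of the refutation: the premise `¬d ∨ ¬e` is used only once. -/
theorem level (t j : ℕ) (hj : j < t) (K : Clause) (hK : K.card ≤ 2)
    (hd : Lit.pos (dv (j+1)) ∉ K ∧ Lit.neg (dv (j+1)) ∉ K)
    (he : Lit.pos (ev (j+1)) ∉ K ∧ Lit.neg (ev (j+1)) ∉ K)
    (hq : Lit.pos (qv (j+1)) ∉ K ∧ Lit.neg (qv (j+1)) ∉ K)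
    {a b w : ℕ} (U : PDer t ({Lit.pos (dv (j+1)), Lit.neg (qv (j+1))} ∪ K) a)
    (V : PDer t ({Lit.pos (ev (j+1)), Lit.pos (qv (j+1))} ∪ K) b)
    (W : PDer t {Lit.neg (dv (j+1)), Lit.neg (ev (j+1))} w) :
    PDer t K (3 * a + 2 * b + w + 100) := by
  have D1 : PDer t {Lit.pos (qv (j+1)), Lit.pos (dv (j+1)), Lit.neg (ev (j+1))} 3 := by
    refine PDer.axExt _ ?_ ?_ _ Finset.card_le_three
    · simp only [DeltaT, List.mem_toFinset, List.mem_flatMap]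
      exact ⟨j, by simp; omega, by simp⟩
    · simp [Clause.Taut, dv, ev, qv] <;> omega
  have D2 : PDer t {Lit.neg (qv (j+1)), Lit.neg (dv (j+1))} 2 := by
    refine PDer.axExt _ ?_ ?_ _ Finset.card_le_two
    · simp only [DeltaT, List.mem_toFinset, List.mem_flatMap]
      exact ⟨j, by simp; omega, by simp⟩
    · simp [Clause.Taut]
  have n1 : dv (j+1) ≠ ev (j+1) := by simp [dv, ev]
  have n2 : dv (j+1) ≠ qv (j+1) := by simp [dv, qv]
  have n3 : ev (j+1) ≠ qv (j+1) := by simp [ev, qv]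
  generalize dv (j+1) = d at *
  generalize ev (j+1) = e at *
  generalize qv (j+1) = q at *
  obtain ⟨hd1, hd2⟩ := hd
  obtain ⟨he1, he2⟩ := he
  obtain ⟨hq1, hq2⟩ := hq
  have c1 : ∀ l : Lit, ({l} ∪ K : Clause).card ≤ 4 := fun l => by
    refine (Finset.card_union_le _ _).trans ?_
    simp; omega
  have c2 : ∀ l m : Lit, ({l, m} ∪ K : Clause).card ≤ 4 := fun l m => by
    refine (Finset.card_union_le _ _).trans ?_
    have : ({l, m} : Clause).card ≤ 2 := Finset.card_le_two
    omega
  have P1 := PDer.res U D2 d (by simp) (by simp) ({Lit.neg q} ∪ K)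
    (by ext l; simp <;> grind) 4 (c1 _)
  have P2 := PDer.res V P1 q (by simp) (by simp) ({Lit.pos e} ∪ K)
    (by ext l; simp <;> grind) 4 (c1 _)
  have P3 := PDer.res P2 D1 e (by simp) (by simp) ({Lit.pos q, Lit.pos d} ∪ K)
    (by ext l; simp <;> grind) 4 (c2 _ _)
  have P4 := PDer.res P3 P1 q (by simp) (by simp) ({Lit.pos d} ∪ K)
    (by ext l; simp <;> grind) 4 (c1 _)
  have P5 := PDer.res P4 W d (by simp) (by simp) ({Lit.neg e} ∪ K)
    (by ext l; simp <;> grind) 4 (c1 _)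
  have P6 := PDer.res P2 P5 e (by simp) (by simp) K
    (by ext l; simp <;> grind) 4 (by omega)
  exact P6.mono (by omega)

theorem chain (t : ℕ) (ht : 1 ≤ t) :
    ∀ j < t, PDer t {Lit.neg (dv (j+1)), Lit.neg (ev (j+1))} (6 + 120 * j) := by
  intro j
  induction j with
  | zero =>
    intro _
    refine PDer.mono (PDer.res (ax_C1 t ht) (ax_C0 t ht) (dv 0) (by simp) (by simp) _ ?_ 2
      Finset.card_le_two) (by omega)
    have : dv 0 ≠ dv 1 := by simp [dv]
    ext l; simp <;> grind
  | succ j ih =>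
    intro hj
    refine (level t j (by omega) _ Finset.card_le_two ?_ ?_ ?_ (a := 4) (b := 4) ?_ ?_
      (ih (by omega))).mono (by omega)
    · simp [dv, ev] <;> omega
    · simp [dv, ev] <;> omega
    · simp [dv, ev, qv] <;> omega
    · convert ax_even t j hj using 1; ext l; simp only [Finset.mem_union, Finset.mem_insert, Finset.mem_singleton, or_assoc]
    · convert ax_odd t j hj using 1; ext l; simp only [Finset.mem_union, Finset.mem_insert, Finset.mem_singleton, or_assoc]

end PsiTree

/-- with the extension clauses Δ (clausal forms of
q_i ↔ (¬d_i ∧ e_i)) and σ_{v,t} = { x_i ↦ q_i }, the formula Ψ_t has a tree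
refutation in IR-calc(P_t, M_t, Δ, σ_{v,t}) of size polynomial in t. -/
theorem short_tree_refutation_Psi_ircalc_delta_subst :
    ∃ c : ℕ, ∀ t : ℕ, 1 ≤ t →
      ∃ d : IRTree (PsiFq t) (DeltaT t) (sigmaQv t) ∅, d.size ≤ c * t ^ c := by
  refine ⟨200, fun t ht => ?_⟩
  obtain ⟨j, rfl⟩ : ∃ j, t = j + 1 := ⟨t - 1, by omega⟩
  have U := PsiTree.last_even (j+1) ht
  have V := PsiTree.last_odd (j+1) ht
  have W := PsiTree.chain (j+1) ht j (by omega)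
  have R := PsiTree.level (j+1) j (by omega) ∅ (by simp) (by simp) (by simp) (by simp)
    (by simpa using U) (by simpa using V) W
  obtain ⟨d, hd⟩ := R
  refine ⟨d, hd.trans ?_⟩
  have h1 : (j+1)^2 ≤ (j+1)^200 := Nat.pow_le_pow_right (by omega) (by omega)
  calc _ ≤ 200 * (j+1)^2 := by nlinarith
    _ ≤ _ := Nat.mul_le_mul_left _ h1
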